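/- arXiv:1301.4660 — 2 statements merged into one kernel-verified Lean document; each statement's English description precedes it below -/
import Mathlib

section
/- Fix s ≥ 0 and τ > 0, and let κ₁, κ₂, σ, T(r), v(r), θ_k(r), V(r) be as follows: κ₁ = 4√2·τ/((4s+1)(4s+2τ+1)), κ₂ = 4√2·τ·(2π)^{2τ}/((4s+2τ+1)(4s+4τ+1)); σ_0 = 1 and σ_k = |k|^s for k ≠ 0; T(r) = (κ₁/κ₂)^{1/(2τ)} r^{-1/τ}; v(r) = (1/κ₁)(κ₂/κ₁)^{(4s+1)/(2τ)} r^{2+(4s+1)/τ}; θ_k(r)² = √2·v(r)·σ_k⁴·max(0, 1 − (|k|/T(r))^{2τ}); V(r) = (∑_{k∈ℤ} θ_k(r)⁴/(2σ_k⁴))^{1/2}. Define the optimal weights w_k^⋆(r) = θ_k(r)²/(2σ_k²·V(r)). Then there exist C > 0 and r₀ > 0 such that for all 0 < r < r₀, sup_{k∈ℤ} w_k^⋆(r) ≤ C · r^{1/(2τ)}; in particular sup_k w_k^⋆(r) → 0 as r → 0⁺. -/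
open scoped BigOperators

noncomputable section

/-- `κ₁` from Proposition 3.1. -/
def kappa1 (s τ : ℝ) : ℝ := 4 * Real.sqrt 2 * τ / ((4 * s + 1) * (4 * s + 2 * τ + 1))

/-- `κ₂` from Proposition 3.1. -/
def kappa2 (s τ : ℝ) : ℝ :=
  4 * Real.sqrt 2 * τ * (2 * Real.pi) ^ (2 * τ) / ((4 * s + 2 * τ + 1) * (4 * s + 4 * τ + 1))

/-- `κ₃` from Proposition 3.1. -/
def kappa3 (s τ : ℝ) : ℝ :=
  1 / (4 * s + 1) - 2 / (4 * s + 2 * τ + 1) + 1 / (4 * s + 4 * τ + 1)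

/-- The constant `c(τ,s)` from Proposition 3.1. -/
def cConst (s τ : ℝ) : ℝ :=
  Real.sqrt (2 * (kappa1 s τ / kappa2 s τ) ^ (-(4 * s + 1) / (2 * τ)) *
    kappa3 s τ / (kappa1 s τ) ^ 2)

/-- The standard deviations: `σ 0 = 1` and `σ k = |k|^s` for `k ≠ 0`. -/
def sigmaSeq (s : ℝ) (k : ℤ) : ℝ := if k = 0 then 1 else |(k : ℝ)| ^ s

/-- The truncation level `T(r)`. -/
def Tlevel (s τ r : ℝ) : ℝ := (kappa1 s τ / kappa2 s τ) ^ (1 / (2 * τ)) * r ^ (-(1 / τ))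

/-- The scaling `v(r)`. -/
def vScale (s τ r : ℝ) : ℝ :=
  (1 / kappa1 s τ) * (kappa2 s τ / kappa1 s τ) ^ ((4 * s + 1) / (2 * τ)) *
    r ^ (2 + (4 * s + 1) / τ)

/-- The square of the extremal sequence: `θ_k(r)²`. -/
def thetaSq (s τ r : ℝ) (k : ℤ) : ℝ :=
  Real.sqrt 2 * vScale s τ r * (sigmaSeq s k) ^ 4 *
    max 0 (1 - (|(k : ℝ)| / Tlevel s τ r) ^ (2 * τ))

/-- The value `V(r) = (∑_k θ_k(r)⁴/(2σ_k⁴))^{1/2}`. -/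
def Vvalue (s τ r : ℝ) : ℝ :=
  Real.sqrt (∑' k : ℤ, (thetaSq s τ r k) ^ 2 / (2 * (sigmaSeq s k) ^ 4))

/-- The optimal weights `w_k^⋆(r) = θ_k(r)²/(2σ_k²·V(r))`. -/
def wStar (s τ r : ℝ) (k : ℤ) : ℝ := thetaSq s τ r k / (2 * (sigmaSeq s k) ^ 2 * Vvalue s τ r)

lemma sigmaSeq_pos (s : ℝ) (k : ℤ) : 0 < sigmaSeq s k := by
  unfold sigmaSeq
  split_ifs with h
  · exact one_pos
  · exact Real.rpow_pos_of_pos (abs_pos.mpr (Int.cast_ne_zero.mpr h)) s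

lemma sigmaSeq_le_rpow {s T : ℝ} (hs : 0 ≤ s) (hT : 1 ≤ T) {k : ℤ} (hk : |(k : ℝ)| ≤ T) :
    sigmaSeq s k ≤ T ^ s := by
  unfold sigmaSeq
  split_ifs
  · exact Real.one_le_rpow hT hs
  · exact Real.rpow_le_rpow (abs_nonneg _) hk hs

lemma rpow_le_sigmaSeq {s x : ℝ} (hs : 0 ≤ s) (hx : 0 < x) {k : ℤ} (hk : x ≤ k) :
    x ^ s ≤ sigmaSeq s k := by
  have hk0 : (0 : ℝ) < k := hx.trans_le hk
  have : k ≠ 0 := by rintro rfl; simp at hk0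
  rw [sigmaSeq, if_neg this, abs_of_pos hk0]
  exact Real.rpow_le_rpow hx.le hk hs

lemma kappa1_pos {s τ : ℝ} (hs : 0 ≤ s) (hτ : 0 < τ) : 0 < kappa1 s τ := by
  unfold kappa1; positivity

lemma kappa2_pos {s τ : ℝ} (hs : 0 ≤ s) (hτ : 0 < τ) : 0 < kappa2 s τ := by
  unfold kappa2; positivity

lemma vScale_pos {s τ r : ℝ} (hs : 0 ≤ s) (hτ : 0 < τ) (hr : 0 < r) : 0 < vScale s τ r := by
  have := kappa1_pos hs hτ
  have := kappa2_pos hs hτ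
  unfold vScale; positivity

lemma Tlevel_pos {s τ r : ℝ} (hs : 0 ≤ s) (hτ : 0 < τ) (hr : 0 < r) : 0 < Tlevel s τ r := by
  have := kappa1_pos hs hτ
  have := kappa2_pos hs hτ
  unfold Tlevel; positivity

lemma thetaSq_nonneg {s τ r : ℝ} (hs : 0 ≤ s) (hτ : 0 < τ) (hr : 0 < r) (k : ℤ) :
    0 ≤ thetaSq s τ r k := by
  have := vScale_pos hs hτ hr
  have := sigmaSeq_pos s k
  unfold thetaSq; positivity

lemma wStar_nonneg {s τ r : ℝ} (hs : 0 ≤ s) (hτ : 0 < τ) (hr : 0 < r) (k : ℤ) :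
    0 ≤ wStar s τ r k := by
  have := thetaSq_nonneg hs hτ hr k
  unfold wStar Vvalue; positivity

lemma thetaSq_eq_zero {s τ r : ℝ} (hs : 0 ≤ s) (hτ : 0 < τ) (hr : 0 < r) {k : ℤ}
    (hk : Tlevel s τ r ≤ |(k : ℝ)|) : thetaSq s τ r k = 0 := by
  have hT := Tlevel_pos hs hτ hr
  have h1 : 1 ≤ (|(k : ℝ)| / Tlevel s τ r) ^ (2 * τ) :=
    Real.one_le_rpow ((one_le_div hT).mpr hk) (by positivity)
  rw [thetaSq, max_eq_left (by linarith), mul_zero]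

lemma summable_thetaSq_sq_div {s τ r : ℝ} (hs : 0 ≤ s) (hτ : 0 < τ) (hr : 0 < r) :
    Summable fun k : ℤ => (thetaSq s τ r k) ^ 2 / (2 * (sigmaSeq s k) ^ 4) := by
  refine summable_of_ne_finset_zero
    (s := Finset.Icc (-⌈Tlevel s τ r⌉) ⌈Tlevel s τ r⌉) fun k hk => ?_
  rw [thetaSq_eq_zero hs hτ hr]
  · simp
  · by_contra! h
    obtain ⟨h1, h2⟩ := abs_lt.mp h
    have hc := Int.le_ceil (Tlevel s τ r)
    refine hk (Finset.mem_Icc.mpr ⟨?_, ?_⟩)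
    · have : ((-⌈Tlevel s τ r⌉ : ℤ) : ℝ) ≤ k := by push_cast; linarith
      exact_mod_cast this
    · have : (k : ℝ) ≤ (⌈Tlevel s τ r⌉ : ℤ) := by linarith
      exact_mod_cast this

lemma le_thetaSq_sq_div {s τ r : ℝ} (hs : 0 ≤ s) (hτ : 0 < τ) (hr : 0 < r) {k : ℤ}
    (hk₁ : Tlevel s τ r / 4 ≤ k) (hk₂ : (k : ℝ) ≤ Tlevel s τ r / 2) :
    (vScale s τ r * ((Tlevel s τ r / 4) ^ s) ^ 2 * (1 - (1 / 2 : ℝ) ^ (2 * τ))) ^ 2 ≤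
      (thetaSq s τ r k) ^ 2 / (2 * (sigmaSeq s k) ^ 4) := by
  have hT := Tlevel_pos hs hτ hr
  have hv := vScale_pos hs hτ hr
  have hσ := sigmaSeq_pos s k
  have hσ' := rpow_le_sigmaSeq hs (by positivity) hk₁
  have hk0 : (0 : ℝ) < k := lt_of_lt_of_le (by positivity) hk₁
  have hhalf : (1 / 2 : ℝ) ^ (2 * τ) ≤ 1 :=
    Real.rpow_le_one (by norm_num) (by norm_num) (by positivity)
  have hm : 1 - (1 / 2 : ℝ) ^ (2 * τ) ≤ max 0 (1 - (|(k : ℝ)| / Tlevel s τ r) ^ (2 * τ)) := by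
    refine le_max_of_le_right (sub_le_sub_left ?_ _)
    refine Real.rpow_le_rpow (by positivity) ?_ (by positivity)
    rw [abs_of_pos hk0, div_le_iff₀ hT]
    linarith
  have heq : (thetaSq s τ r k) ^ 2 / (2 * (sigmaSeq s k) ^ 4) =
      (vScale s τ r * (sigmaSeq s k) ^ 2 *
        max 0 (1 - (|(k : ℝ)| / Tlevel s τ r) ^ (2 * τ))) ^ 2 := by
    rw [thetaSq, mul_pow, mul_pow, mul_pow, Real.sq_sqrt (by norm_num)]
    field_simp
  rw [heq]
  have : 0 ≤ 1 - (1 / 2 : ℝ) ^ (2 * τ) := by linarith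
  gcongr

lemma le_Vvalue {s τ r : ℝ} (hs : 0 ≤ s) (hτ : 0 < τ) (hr : 0 < r) (hT8 : 8 ≤ Tlevel s τ r) :
    √(Tlevel s τ r / 8) *
      (vScale s τ r * ((Tlevel s τ r / 4) ^ s) ^ 2 * (1 - (1 / 2 : ℝ) ^ (2 * τ))) ≤
      Vvalue s τ r := by
  set T := Tlevel s τ r
  set A := vScale s τ r * ((T / 4) ^ s) ^ 2 * (1 - (1 / 2 : ℝ) ^ (2 * τ))
  set N := ⌊T / 4⌋₊
  have hN₁ : (N : ℝ) ≤ T / 4 := Nat.floor_le (by positivity)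
  have hN₂ : T / 4 < N + 1 := Nat.lt_floor_add_one _
  refine Real.le_sqrt_of_sq_le ?_
  rw [mul_pow, Real.sq_sqrt (by positivity)]
  calc T / 8 * A ^ 2 ≤ N * A ^ 2 := by gcongr; linarith
    _ = ∑ _k ∈ Finset.Icc ((N : ℤ) + 1) (2 * N), A ^ 2 := by
        rw [Finset.sum_const, Int.card_Icc, nsmul_eq_mul]
        congr 2
        omega
    _ ≤ ∑ k ∈ Finset.Icc ((N : ℤ) + 1) (2 * N),
          (thetaSq s τ r k) ^ 2 / (2 * (sigmaSeq s k) ^ 4) := by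
        refine Finset.sum_le_sum fun k hk => ?_
        obtain ⟨h1, h2⟩ := Finset.mem_Icc.mp hk
        have h1' : (N : ℝ) + 1 ≤ k := by exact_mod_cast h1
        have h2' : (k : ℝ) ≤ 2 * N := by exact_mod_cast h2
        exact le_thetaSq_sq_div hs hτ hr (by linarith) (by linarith)
    _ ≤ _ := by
        refine (summable_thetaSq_sq_div hs hτ hr).sum_le_tsum _ fun k _ => ?_
        have := sigmaSeq_pos s k
        positivity

lemma thetaSq_div_le {s τ r : ℝ} (hs : 0 ≤ s) (hτ : 0 < τ) (hr : 0 < r)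
    (hT1 : 1 ≤ Tlevel s τ r) (k : ℤ) :
    thetaSq s τ r k / (2 * (sigmaSeq s k) ^ 2) ≤ vScale s τ r * (Tlevel s τ r ^ s) ^ 2 := by
  have hv := vScale_pos hs hτ hr
  have hσ := sigmaSeq_pos s k
  rcases le_total (Tlevel s τ r) |(k : ℝ)| with hk | hk
  · rw [thetaSq_eq_zero hs hτ hr hk, zero_div]
    positivity
  · have hσ' := sigmaSeq_le_rpow hs hT1 hk
    have hm : max 0 (1 - (|(k : ℝ)| / Tlevel s τ r) ^ (2 * τ)) ≤ 1 := by
      have : 0 ≤ (|(k : ℝ)| / Tlevel s τ r) ^ (2 * τ) := by positivity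
      exact max_le zero_le_one (by linarith)
    have h2 : √2 / 2 ≤ 1 := by
      rw [div_le_one two_pos, Real.sqrt_le_left (by norm_num)]
      norm_num
    calc thetaSq s τ r k / (2 * (sigmaSeq s k) ^ 2)
        = (√2 / 2) * (vScale s τ r * (sigmaSeq s k) ^ 2) *
          max 0 (1 - (|(k : ℝ)| / Tlevel s τ r) ^ (2 * τ)) := by
          rw [thetaSq]; field_simp
      _ ≤ 1 * (vScale s τ r * (Tlevel s τ r ^ s) ^ 2) * 1 := by gcongr
      _ = _ := by ring

lemma wStar_le {s τ r : ℝ} (hs : 0 ≤ s) (hτ : 0 < τ) (hr : 0 < r) (hT8 : 8 ≤ Tlevel s τ r)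
    (k : ℤ) :
    wStar s τ r k ≤ √8 * ((4 : ℝ) ^ s) ^ 2 / (1 - (1 / 2 : ℝ) ^ (2 * τ)) / √(Tlevel s τ r) := by
  have hT := Tlevel_pos hs hτ hr
  have hv := vScale_pos hs hτ hr
  have hμ : 0 < 1 - (1 / 2 : ℝ) ^ (2 * τ) :=
    sub_pos.mpr (Real.rpow_lt_one (by norm_num) (by norm_num) (by positivity))
  have hV := le_Vvalue hs hτ hr hT8
  calc wStar s τ r k = thetaSq s τ r k / (2 * (sigmaSeq s k) ^ 2) / Vvalue s τ r := by
        rw [wStar, div_div]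
    _ ≤ vScale s τ r * (Tlevel s τ r ^ s) ^ 2 / (√(Tlevel s τ r / 8) *
          (vScale s τ r * ((Tlevel s τ r / 4) ^ s) ^ 2 * (1 - (1 / 2 : ℝ) ^ (2 * τ)))) := by
        have := thetaSq_div_le hs hτ hr (by linarith) k
        gcongr
    _ = _ := by
        rw [Real.sqrt_div hT.le, Real.div_rpow hT.le (by norm_num)]
        field_simp

lemma sqrt_Tlevel {s τ r : ℝ} (hs : 0 ≤ s) (hτ : 0 < τ) (hr : 0 < r) :
    √(Tlevel s τ r) =
      √((kappa1 s τ / kappa2 s τ) ^ (1 / (2 * τ))) * (r ^ (1 / (2 * τ)))⁻¹ := by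
  have := kappa1_pos hs hτ
  have := kappa2_pos hs hτ
  rw [Tlevel, Real.sqrt_mul (by positivity), Real.sqrt_eq_rpow (r ^ _), ← Real.rpow_mul hr.le,
    ← Real.rpow_neg hr.le]
  congr 2
  field_simp

lemma eight_le_Tlevel {s τ r : ℝ} (hs : 0 ≤ s) (hτ : 0 < τ) (hr : 0 < r)
    (hr₀ : r < ((kappa1 s τ / kappa2 s τ) ^ (1 / (2 * τ)) / 8) ^ τ) : 8 ≤ Tlevel s τ r := by
  have := kappa1_pos hs hτ
  have := kappa2_pos hs hτ
  have h : r ^ (1 / τ) ≤ (kappa1 s τ / kappa2 s τ) ^ (1 / (2 * τ)) / 8 := by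
    rw [one_div τ, Real.rpow_inv_le_iff_of_pos hr.le (by positivity) hτ]
    exact hr₀.le
  rw [Tlevel, Real.rpow_neg hr.le, ← div_eq_mul_inv, le_div_iff₀ (by positivity)]
  linarith

/-- Proposition 3.1 of the paper, bound on the maximal optimal weight: there are `C > 0` and
`r₀ > 0` such that `sup_k w_k^⋆(r) ≤ C·r^{1/(2τ)}` for all `0 < r < r₀`; in particular
`sup_k w_k^⋆(r) → 0` as `r → 0⁺`. -/
theorem max_optimal_weight_bound (s τ : ℝ) (hs : 0 ≤ s) (hτ : 0 < τ) :
    (∃ C > (0 : ℝ), ∃ r₀ > (0 : ℝ), ∀ r : ℝ, 0 < r → r < r₀ →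
      (⨆ k : ℤ, wStar s τ r k) ≤ C * r ^ (1 / (2 * τ)) ∧
      ∀ k : ℤ, wStar s τ r k ≤ C * r ^ (1 / (2 * τ))) ∧
    Filter.Tendsto (fun r : ℝ => ⨆ k : ℤ, wStar s τ r k)
      (nhdsWithin 0 (Set.Ioi 0)) (nhds 0) := by
  have hκ₁ := kappa1_pos hs hτ
  have hκ₂ := kappa2_pos hs hτ
  have hμ : 0 < 1 - (1 / 2 : ℝ) ^ (2 * τ) :=
    sub_pos.mpr (Real.rpow_lt_one (by norm_num) (by norm_num) (by positivity))
  have hbound : ∃ C > (0 : ℝ), ∃ r₀ > (0 : ℝ), ∀ r : ℝ, 0 < r → r < r₀ →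
      (⨆ k : ℤ, wStar s τ r k) ≤ C * r ^ (1 / (2 * τ)) ∧
      ∀ k : ℤ, wStar s τ r k ≤ C * r ^ (1 / (2 * τ)) := by
    refine ⟨√8 * ((4 : ℝ) ^ s) ^ 2 / (1 - (1 / 2 : ℝ) ^ (2 * τ)) /
      √((kappa1 s τ / kappa2 s τ) ^ (1 / (2 * τ))), by positivity,
      ((kappa1 s τ / kappa2 s τ) ^ (1 / (2 * τ)) / 8) ^ τ, by positivity, fun r hr hr₀ => ?_⟩
    have h : ∀ k : ℤ, wStar s τ r k ≤ √8 * ((4 : ℝ) ^ s) ^ 2 / (1 - (1 / 2 : ℝ) ^ (2 * τ)) /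
        √((kappa1 s τ / kappa2 s τ) ^ (1 / (2 * τ))) * r ^ (1 / (2 * τ)) := fun k => by
      refine (wStar_le hs hτ hr (eight_le_Tlevel hs hτ hr hr₀) k).trans_eq ?_
      rw [sqrt_Tlevel hs hτ hr, ← div_div, div_inv_eq_mul]
    exact ⟨ciSup_le h, h⟩
  refine ⟨hbound, ?_⟩
  obtain ⟨C, -, r₀, hr₀, hC⟩ := hbound
  have hlim : Filter.Tendsto (fun r : ℝ => C * r ^ (1 / (2 * τ)))
      (nhdsWithin 0 (Set.Ioi 0)) (nhds 0) := by
    have h := ((Real.continuous_rpow_const (q := 1 / (2 * τ)) (by positivity)).tendsto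
      0).const_mul C
    rw [Real.zero_rpow (by positivity), mul_zero] at h
    exact h.mono_left nhdsWithin_le_nhds
  refine squeeze_zero' ?_ ?_ hlim
  · filter_upwards [self_mem_nhdsWithin] with r hr
    exact Real.iSup_nonneg (wStar_nonneg hs hτ hr)
  · filter_upwards [Ioo_mem_nhdsGT hr₀] with r hr
    exact (hC r hr.1 hr.2).1

end
end

section
/- Let M, N, m, n be positive integers with m ≤ M, n ≤ N, and fix A ⊆ Fin M with card A = m and B ⊆ Fin N with card B = n. Let S ⊆ ℤ be a finite set, w : S → ℝ with w_k ≥ 0 and ∑_{k∈S} w_k² = 1/2, σ : S → ℝ with σ_k > 0, ε > 0, and means θ_{ij,k} ∈ ℝ for (i,j,k) ∈ Fin M × Fin N × S with θ_{ij,k} = 0 whenever (i,j) ∉ A × B. Let P be the product over (i,j,k) of Gaussian measures with mean θ_{ij,k} and variance ε²σ_k², let t_{ij}(x) = ∑_{k∈S} w_k ((x_{ij,k}/(εσ_k))² − 1), and let t^{χ²}(x) = (MN)^{−1/2} ∑_{(i,j)∈Fin M×Fin N} t_{ij}(x). Suppose a > 0 is such that ∑_{k∈S} w_k θ_{ij,k}²/(ε²σ_k²)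 ≥ a for every (i,j) ∈ A × B, and set μ = ∫ t^{χ²} dP. Then: (i) μ ≥ a·mn/√(MN); (ii) Var_P(t^{χ²}) ≤ 1 + 4(max_{k∈S} w_k)·μ/√(MN); and (iii) for every H with 0 < H < μ, P( { x : t^{χ²}(x) ≤ H } ) ≤ ( 1 + 4(max_{k∈S} w_k)·μ/√(MN) ) / (μ − H)². -/
open MeasureTheory ProbabilityTheory
open scoped BigOperators NNReal ENNReal

/-- The fourth moment of a real Gaussian distribution. -/
lemma integral_pow_four_gaussianReal (m : ℝ) (v : ℝ≥0) :
    ∫ x, x ^ 4 ∂gaussianReal m v = m ^ 4 + 6 * m ^ 2 * v + 3 * (v : ℝ) ^ 2 := by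
  have hE : ∀ t : ℝ, HasDerivAt (fun t : ℝ => Real.exp (m * t + v * t ^ 2 / 2))
      ((m + v * t) * Real.exp (m * t + v * t ^ 2 / 2)) t := fun t => by
    have h : HasDerivAt (fun t : ℝ => m * t + v * t ^ 2 / 2) (m + v * t) t := by
      convert! ((hasDerivAt_id t).const_mul m).add
        ((((hasDerivAt_id t).pow 2).const_mul (v : ℝ)).div_const 2) using 1
      simp only [id]
      ring
    convert! h.exp using 1
    ring
  have hu : ∀ t : ℝ, HasDerivAt (fun t : ℝ => m + v * t) (v : ℝ) t := fun t => by
    simpa using ((hasDerivAt_id t).const_mul (v : ℝ)).const_add m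
  calc ∫ x, x ^ 4 ∂gaussianReal m v
    _ = iteratedDeriv 4 (mgf (fun x ↦ x) (gaussianReal m v)) 0 := by
      rw [iteratedDeriv_mgf_zero] <;> simp
    _ = _ := by
      have h1 : deriv (fun t : ℝ => Real.exp (m * t + v * t ^ 2 / 2)) =
          fun t => (m + v * t) * Real.exp (m * t + v * t ^ 2 / 2) :=
        funext fun t => (hE t).deriv
      have h2 : deriv (fun t : ℝ => (m + v * t) * Real.exp (m * t + v * t ^ 2 / 2)) =
          fun t => (v + (m + v * t) ^ 2) * Real.exp (m * t + v * t ^ 2 / 2) :=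
        funext fun t => by
          rw [((hu t).fun_mul (hE t)).deriv]
          ring
      have h3 : deriv (fun t : ℝ => (v + (m + v * t) ^ 2) * Real.exp (m * t + v * t ^ 2 / 2)) =
          fun t => (3 * v * (m + v * t) + (m + v * t) ^ 3) *
            Real.exp (m * t + v * t ^ 2 / 2) :=
        funext fun t => by
          rw [((((hu t).fun_pow 2).const_add (v : ℝ)).fun_mul (hE t)).deriv]
          push_cast
          ring
      rw [mgf_fun_id_gaussianReal, iteratedDeriv_succ, iteratedDeriv_succ, iteratedDeriv_succ,
        iteratedDeriv_one, h1, h2, h3,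
        ((((hu 0).const_mul (3 * (v : ℝ))).fun_add ((hu 0).fun_pow 3)).fun_mul (hE 0)).deriv]
      simp
      ring

/-- The second moment of a real Gaussian distribution. -/
lemma integral_sq_gaussianReal (m : ℝ) (v : ℝ≥0) :
    ∫ x, x ^ 2 ∂gaussianReal m v = m ^ 2 + v := by
  have h := variance_eq_sub (memLp_id_gaussianReal (μ := m) (v := v) 2)
  simp at h
  linarith

lemma memLp_sq_gaussianReal (m : ℝ) (v : ℝ≥0) :
    MemLp (fun x => x ^ 2) 2 (gaussianReal m v) := by
  refine (memLp_two_iff_integrable_sq (by fun_prop)).2 ?_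
  have h := (memLp_id_gaussianReal (μ := m) (v := v) 4).integrable_norm_pow (p := 4) (by norm_num)
  refine h.congr (ae_of_all _ fun x => ?_)
  simp only [id, Real.norm_eq_abs]
  rw [← pow_mul, Even.pow_abs (by decide)]

/-- The variance of the square of a real Gaussian variable. -/
lemma variance_sq_gaussianReal (m : ℝ) (v : ℝ≥0) :
    Var[fun x => x ^ 2; gaussianReal m v] = 4 * m ^ 2 * v + 2 * (v : ℝ) ^ 2 := by
  rw [variance_eq_sub (memLp_sq_gaussianReal m v), integral_sq_gaussianReal]
  have h : ∫ x, ((fun x : ℝ => x ^ 2) ^ 2) x ∂gaussianReal m v =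
      ∫ x, x ^ 4 ∂gaussianReal m v := by
    congr 1 with x
    simp only [Pi.pow_apply]
    ring
  rw [h, integral_pow_four_gaussianReal]
  ring

lemma memLp_mul_div_sq_sub_one_gaussianReal (c s m : ℝ) (v : ℝ≥0) :
    MemLp (fun x => c * ((x / s) ^ 2 - 1)) 2 (gaussianReal m v) := by
  simp_rw [div_pow, div_eq_mul_inv]
  exact (((memLp_sq_gaussianReal m v).mul_const _).sub (memLp_const 1)).const_mul c

lemma integral_mul_div_sq_sub_one_gaussianReal (c m : ℝ) {s : ℝ} (hs : s ≠ 0) :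
    ∫ x, c * ((x / s) ^ 2 - 1) ∂gaussianReal m (s ^ 2).toNNReal = c * (m / s) ^ 2 := by
  have hi : Integrable (fun x : ℝ => x ^ 2 / s ^ 2) (gaussianReal m (s ^ 2).toNNReal) :=
    ((memLp_sq_gaussianReal m _).integrable (by norm_num)).div_const _
  simp_rw [div_pow]
  rw [integral_const_mul, integral_sub hi (integrable_const 1), integral_div,
    integral_sq_gaussianReal, Real.coe_toNNReal _ (sq_nonneg s)]
  simp
  field_simp
  simp

lemma variance_mul_div_sq_sub_one_gaussianReal (c m : ℝ) {s : ℝ} (hs : s ≠ 0) :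
    Var[fun x => c * ((x / s) ^ 2 - 1); gaussianReal m (s ^ 2).toNNReal] =
      c ^ 2 * (2 + 4 * (m / s) ^ 2) := by
  simp_rw [div_pow, div_eq_mul_inv]
  rw [variance_const_mul, variance_sub_const (by fun_prop), variance_mul_const,
    variance_sq_gaussianReal, Real.coe_toNNReal _ (sq_nonneg s)]
  field_simp
  ring

section WeightedChiSquare

variable {ι : Type*} [Fintype ι] (c s θ : ι → ℝ)

lemma memLp_sum_pi_gaussianReal (v : ι → ℝ≥0) :
    MemLp (fun x : ι → ℝ => ∑ p, c p * ((x p / s p) ^ 2 - 1)) 2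
      (Measure.pi fun p => gaussianReal (θ p) (v p)) :=
  memLp_finsetSum _ fun p _ =>
    (memLp_mul_div_sq_sub_one_gaussianReal (c p) (s p) (θ p) (v p)).comp_measurePreserving
      (measurePreserving_eval (fun p => gaussianReal (θ p) (v p)) p)

/-- The mean of a weighted sum of noncentral centred χ² variables. -/
lemma integral_sum_pi_gaussianReal (hs : ∀ p, s p ≠ 0) :
    ∫ x : ι → ℝ, ∑ p, c p * ((x p / s p) ^ 2 - 1)
      ∂(Measure.pi fun p => gaussianReal (θ p) (s p ^ 2).toNNReal) =
      ∑ p, c p * (θ p / s p) ^ 2 := by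
  have hL := fun p => memLp_mul_div_sq_sub_one_gaussianReal (c p) (s p) (θ p) (s p ^ 2).toNNReal
  refine (integral_finsetSum _ fun p _ => ((hL p).comp_measurePreserving
    (measurePreserving_eval (fun p => gaussianReal (θ p) (s p ^ 2).toNNReal) p)).integrable
      (by norm_num)).trans ?_
  refine Finset.sum_congr rfl fun p _ => ?_
  rw [← integral_mul_div_sq_sub_one_gaussianReal (c p) (θ p) (hs p)]
  exact integral_comp_eval (μ := fun p => gaussianReal (θ p) (s p ^ 2).toNNReal)
    (hL p).aestronglyMeasurable

/-- The variance of a weighted sum of independent noncentral χ² variables. -/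
lemma variance_sum_pi_gaussianReal (hs : ∀ p, s p ≠ 0) :
    Var[fun x : ι → ℝ => ∑ p, c p * ((x p / s p) ^ 2 - 1);
      Measure.pi fun p => gaussianReal (θ p) (s p ^ 2).toNNReal] =
      ∑ p, c p ^ 2 * (2 + 4 * (θ p / s p) ^ 2) := by
  have h := variance_sum_pi (fun p =>
    memLp_mul_div_sq_sub_one_gaussianReal (c p) (s p) (θ p) (s p ^ 2).toNNReal)
  simp_rw [variance_mul_div_sq_sub_one_gaussianReal _ _ (hs _)] at h
  rw [← h]
  congr 1 with x
  simp

end WeightedChiSquare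

/-- Chebyshev's inequality for the lower tail. -/
lemma measure_le_le_variance_div_sq {Ω : Type*} [MeasurableSpace Ω] {P : Measure Ω}
    [IsFiniteMeasure P] {X : Ω → ℝ} (hX : MemLp X 2 P) {H : ℝ} (hH : H < ∫ x, X x ∂P) :
    P {x | X x ≤ H} ≤ ENNReal.ofReal (Var[X; P] / (∫ x, X x ∂P - H) ^ 2) := by
  refine (measure_mono fun x hx => ?_).trans (meas_ge_le_variance_div_sq hX (sub_pos.2 hH))
  simp only [Set.mem_ofPred_eq] at hx ⊢
  rw [abs_sub_comm]
  exact (sub_le_sub_left hx _).trans (le_abs_self _)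

/-- Non-asymptotic type II error bound for the χ² test (proof of Theorem 3.1, part 1):
with `μ = E t^{χ²}` one has `μ ≥ a·mn/√(MN)`,
`Var(t^{χ²}) ≤ 1 + 4(max_k w_k)μ/√(MN)`, and for `0 < H < μ`,
`P(t^{χ²} ≤ H) ≤ (1 + 4(max_k w_k)μ/√(MN))/(μ-H)²`. -/
theorem chi_square_test_type_II_bound
    (M N m n : ℕ) (hM : 0 < M) (hN : 0 < N) (hm : 0 < m) (hn : 0 < n)
    (hmM : m ≤ M) (hnN : n ≤ N)
    (A : Finset (Fin M)) (hA : A.card = m) (B : Finset (Fin N)) (hB : B.card = n)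
    (S : Finset ℤ) (w σ : ℤ → ℝ)
    (hw0 : ∀ k ∈ S, 0 ≤ w k) (hw2 : ∑ k ∈ S, (w k) ^ 2 = 1 / 2)
    (hσ : ∀ k ∈ S, 0 < σ k) (ε : ℝ) (hε : 0 < ε)
    (θ : Fin M → Fin N → ℤ → ℝ)
    (hθ0 : ∀ i j k, ¬(i ∈ A ∧ j ∈ B) → θ i j k = 0)
    (P : Measure (Fin M × Fin N × S → ℝ))
    (hP : P = Measure.pi fun p : Fin M × Fin N × S =>
      gaussianReal (θ p.1 p.2.1 p.2.2) (Real.toNNReal (ε ^ 2 * (σ p.2.2) ^ 2)))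
    (t : Fin M → Fin N → (Fin M × Fin N × S → ℝ) → ℝ)
    (ht : t = fun i j x => ∑ k : S, w k * ((x (i, j, k) / (ε * σ k)) ^ 2 - 1))
    (tchi : (Fin M × Fin N × S → ℝ) → ℝ)
    (htchi : tchi = fun x => ((M : ℝ) * N) ^ (-(1 / 2) : ℝ) *
      ∑ p : Fin M × Fin N, t p.1 p.2 x)
    (a : ℝ) (ha : 0 < a)
    (hamean : ∀ i ∈ A, ∀ j ∈ B,
      a ≤ ∑ k : S, w k * (θ i j k) ^ 2 / (ε ^ 2 * (σ k) ^ 2))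
    (μ : ℝ) (hμ : μ = ∫ x, tchi x ∂P) :
    a * m * n / Real.sqrt ((M : ℝ) * N) ≤ μ ∧
    (∫ x, (tchi x) ^ 2 ∂P) - (∫ x, tchi x ∂P) ^ 2
      ≤ 1 + 4 * (⨆ k : S, w k) * μ / Real.sqrt ((M : ℝ) * N) ∧
    (∀ H : ℝ, 0 < H → H < μ →
      P {x | tchi x ≤ H}
        ≤ ENNReal.ofReal
            ((1 + 4 * (⨆ k : S, w k) * μ / Real.sqrt ((M : ℝ) * N)) / (μ - H) ^ 2)) := by
  set C : ℝ := ((M : ℝ) * N) ^ (-(1 / 2) : ℝ) with hC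
  have hMN : (0 : ℝ) < (M : ℝ) * N := by positivity
  have hCs : C = (Real.sqrt ((M : ℝ) * N))⁻¹ := by
    rw [hC, Real.rpow_neg hMN.le, Real.sqrt_eq_rpow]
  have hC0 : 0 < C := by rw [hCs]; positivity
  have hC2 : C ^ 2 * ((M : ℝ) * N) = 1 := by
    rw [hCs, inv_pow, Real.sq_sqrt hMN.le, inv_mul_cancel₀ hMN.ne']
  set W : ℝ := ⨆ k : S, w k with hW
  have hwW : ∀ k : S, w k ≤ W := fun k => le_ciSup (f := fun k : S => w k)
    (Set.finite_range _).bddAbove k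
  let s : Fin M × Fin N × S → ℝ := fun p => ε * σ p.2.2
  let c : Fin M × Fin N × S → ℝ := fun p => C * w p.2.2
  let θ' : Fin M × Fin N × S → ℝ := fun p => θ p.1 p.2.1 p.2.2
  have hs : ∀ p, s p ≠ 0 := fun p => (mul_pos hε (hσ _ p.2.2.2)).ne'
  have hP' : P = Measure.pi fun p => gaussianReal (θ' p) (s p ^ 2).toNNReal := by
    simp only [hP, s, θ', mul_pow]
  have htchi' : tchi = fun x => ∑ p, c p * ((x p / s p) ^ 2 - 1) := by
    funext x
    simp only [htchi, ht, Fintype.sum_prod_type, Finset.mul_sum, c, s, mul_assoc]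
  have : IsProbabilityMeasure P := by rw [hP]; infer_instance
  have hL : MemLp tchi 2 P := by
    rw [hP', htchi']
    exact memLp_sum_pi_gaussianReal c s θ' _
  have hmean : μ = ∑ p, c p * (θ' p / s p) ^ 2 := by
    rw [hμ, hP', htchi', integral_sum_pi_gaussianReal c s θ' hs]
  have hvar : Var[tchi; P] = ∑ p, c p ^ 2 * (2 + 4 * (θ' p / s p) ^ 2) := by
    rw [hP', htchi', variance_sum_pi_gaussianReal c s θ' hs]
  have hvar_le : Var[tchi; P] ≤ 1 + 4 * W * μ / Real.sqrt ((M : ℝ) * N) := by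
    have hone : ∑ p, c p ^ 2 * 2 = 1 := by
      have hw2' : ∑ k : S, w k ^ 2 = 1 / 2 := by
        rw [← hw2]
        exact Finset.sum_coe_sort S fun k => w k ^ 2
      simp only [c, Fintype.sum_prod_type, mul_pow, ← Finset.sum_mul, ← Finset.mul_sum, hw2',
        Finset.sum_const, Finset.card_univ, Fintype.card_fin, nsmul_eq_mul]
      linear_combination hC2
    rw [hvar, div_eq_mul_inv, ← hCs, hmean, ← hone, Finset.mul_sum, Finset.sum_mul,
      ← Finset.sum_add_distrib]
    refine Finset.sum_le_sum fun p _ => ?_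
    have h0 : 0 ≤ (w p.2.2) * (W - w p.2.2) :=
      mul_nonneg (hw0 _ p.2.2.2) (sub_nonneg.2 (hwW _))
    have h1 : 0 ≤ C ^ 2 * (θ' p / s p) ^ 2 := by positivity
    have h2 := mul_nonneg h1 h0
    simp only [c]
    linarith
  refine ⟨?_, ?_, fun H _ hH => ?_⟩
  · have hpos : ∀ i j, 0 ≤ ∑ k : S, w k * (θ i j k) ^ 2 / (ε ^ 2 * (σ k) ^ 2) := fun i j =>
      Finset.sum_nonneg fun k _ => by have := hw0 k k.2; positivity
    have hsum : μ = C * ∑ p : Fin M × Fin N,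
        ∑ k : S, w k * (θ p.1 p.2 k) ^ 2 / (ε ^ 2 * (σ k) ^ 2) := by
      rw [hmean]
      simp only [Fintype.sum_prod_type, Finset.mul_sum, c, s, θ', div_pow, mul_pow]
      refine Finset.sum_congr rfl fun i _ => Finset.sum_congr rfl fun j _ =>
        Finset.sum_congr rfl fun k _ => by ring
    have hle : a * m * n ≤ ∑ p : Fin M × Fin N,
        ∑ k : S, w k * (θ p.1 p.2 k) ^ 2 / (ε ^ 2 * (σ k) ^ 2) := by
      calc a * m * n = ∑ p ∈ A ×ˢ B, a := by
            simp only [Finset.sum_const, Finset.card_product, hA, hB, nsmul_eq_mul]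
            push_cast
            ring
        _ ≤ ∑ p ∈ A ×ˢ B, ∑ k : S, w k * (θ p.1 p.2 k) ^ 2 / (ε ^ 2 * (σ k) ^ 2) :=
            Finset.sum_le_sum fun p hp =>
              hamean _ (Finset.mem_product.1 hp).1 _ (Finset.mem_product.1 hp).2
        _ ≤ _ := Finset.sum_le_sum_of_subset_of_nonneg (Finset.subset_univ _)
            fun p _ _ => hpos _ _
    rw [hsum, div_eq_mul_inv, ← hCs, mul_comm]
    exact mul_le_mul_of_nonneg_left hle hC0.le
  · rw [variance_eq_sub hL] at hvar_le
    exact hvar_le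
  · rw [hμ] at hH
    refine (measure_le_le_variance_div_sq hL hH).trans (ENNReal.ofReal_le_ofReal ?_)
    rw [← hμ]
    gcongr
end
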